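/- arXiv:math/0112301 — 2 statements merged into one kernel-verified Lean document; each statement's English description precedes it below -/
import Mathlib

section
/- Parametric Borel's Lemma on a compact manifold: Let M be a compact smooth manifold, V a finite-dimensional real normed vector space, and (α_n)_{n∈ℕ} a sequence of smooth maps α_n : M → V. Then there exists a jointly smooth map f : M × ℝ → V such that for every x ∈ M and every n ∈ ℕ, the n-th iterated derivative at t = 0 of the function t ↦ f(x,t) equals α_n(x). -/
open scoped Manifold ContDiff Topology Nat

section

variable {E V : Type*} [NormedAddCommGroup E] [NormedSpace ℝ E]
  [NormedAddCommGroup V] [NormedSpace ℝ V]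

/-- The derivatives of a slice `t ↦ G (y, t)` are the derivatives of `G` in the direction
`(0, 1)`. -/
lemma iteratedDeriv_slice {G : E × ℝ → V} (hG : ContDiff ℝ ∞ G) (y : E) (t : ℝ) (m : ℕ) :
    iteratedDeriv m (fun s => G (y, s)) t = iteratedFDeriv ℝ m G (y, t) fun _ => (0, 1) := by
  have h : (fun s => G (y, s)) =
      (fun p => G ((y, 0) + p)) ∘ ContinuousLinearMap.inr ℝ E ℝ := by
    ext s; simp
  have hG' : ContDiff ℝ ∞ fun p => G ((y, 0) + p) := by fun_prop
  rw [iteratedDeriv_eq_iteratedFDeriv, h,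
    ContinuousLinearMap.iteratedFDeriv_comp_right _ hG' _ (mod_cast le_top),
    iteratedFDeriv_comp_add_left]
  simp

/-- Stretching the last variable by a factor `L ≥ 1` multiplies bounds on the `k`-th derivative
by at most `L ^ k`. -/
lemma norm_iteratedFDeriv_stretch_le {w : E × ℝ → V} (hw : ContDiff ℝ ∞ w) {k : ℕ} {C : ℝ}
    (hC : ∀ p, ‖iteratedFDeriv ℝ k w p‖ ≤ C) {L : ℝ} (hL : 1 ≤ L) (p : E × ℝ) :
    ‖iteratedFDeriv ℝ k (fun q : E × ℝ => w (q.1, L * q.2)) p‖ ≤ C * L ^ k := by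
  let A : E × ℝ →L[ℝ] E × ℝ :=
    (ContinuousLinearMap.fst ℝ E ℝ).prod (L • ContinuousLinearMap.snd ℝ E ℝ)
  have hA : ‖A‖ ≤ L := by
    refine A.opNorm_le_bound (by linarith) fun q => ?_
    refine max_le ?_ ?_
    · exact (norm_fst_le q).trans (le_mul_of_one_le_left (norm_nonneg q) hL)
    · change ‖L * q.2‖ ≤ L * ‖q‖
      rw [norm_mul, Real.norm_of_nonneg (by linarith : 0 ≤ L)]
      gcongr
      exact norm_snd_le q
  have h : (fun q : E × ℝ => w (q.1, L * q.2)) = w ∘ A := rfl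
  rw [h, ContinuousLinearMap.iteratedFDeriv_comp_right _ hw _ (mod_cast le_top)]
  calc _ ≤ _ := ContinuousMultilinearMap.norm_compContinuousLinearMap_le _ _
    _ ≤ C * L ^ k := by
      rw [Finset.prod_const, Finset.card_univ, Fintype.card_fin]
      have := (norm_nonneg _).trans (hC (A p))
      gcongr
      exact hC _

/-- Scales that grow fast enough to beat countably many constants. -/
lemma exists_scales {ι : Type*} [Finite ι] (C : ι → ℕ → ℕ → ℝ) :
    ∃ L : ℕ → ℝ, (∀ n, 1 ≤ L n) ∧
      ∀ i n k, k < n → (L n ^ n)⁻¹ * (C i n k * L n ^ k) ≤ (1 / 2) ^ n := by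
  cases nonempty_fintype ι
  refine ⟨fun n => 1 + 2 ^ n * ∑ i, ∑ k ∈ Finset.range n, |C i n k|, fun n => ?_, ?_⟩
  · have : 0 ≤ 2 ^ n * ∑ i, ∑ k ∈ Finset.range n, |C i n k| := by positivity
    linarith
  intro i n k hk
  set S := ∑ i, ∑ k ∈ Finset.range n, |C i n k| with hS
  have hCS : |C i n k| ≤ S :=
    (Finset.single_le_sum (f := fun k => |C i n k|) (fun _ _ => abs_nonneg _)
      (Finset.mem_range.2 hk)).trans
      (Finset.single_le_sum (f := fun i => ∑ k ∈ Finset.range n, |C i n k|)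
        (fun _ _ => by positivity) (Finset.mem_univ i))
  have hS0 : 0 ≤ S := (abs_nonneg _).trans hCS
  set L := 1 + 2 ^ n * S
  have hL : 1 ≤ L := le_add_of_nonneg_right (by positivity)
  rw [inv_mul_le_iff₀ (by positivity)]
  calc C i n k * L ^ k ≤ S * L ^ k := by gcongr; exact (le_abs_self _).trans hCS
    _ ≤ ((1 / 2) ^ n * L) * L ^ k := by
      gcongr
      have : (1 / 2 : ℝ) ^ n * 2 ^ n = 1 := by rw [← mul_pow]; norm_num
      have h2 : (0 : ℝ) ≤ (1 / 2) ^ n := by positivity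
      calc S = (1 / 2 : ℝ) ^ n * 2 ^ n * S := by rw [this, one_mul]
        _ ≤ (1 / 2) ^ n * L := by rw [mul_assoc]; gcongr; simp [L]
    _ = (1 / 2) ^ n * L ^ (k + 1) := by ring
    _ ≤ L ^ n * (1 / 2) ^ n := by
      rw [mul_comm]
      gcongr
      exact hk

/-- For a smooth compactly supported `w`, all derivatives are bounded. -/
lemma exists_bound_iteratedFDeriv {w : E → V} (hw : ContDiff ℝ ∞ w) (hc : HasCompactSupport w)
    (k : ℕ) : ∃ C, ∀ p, ‖iteratedFDeriv ℝ k w p‖ ≤ C :=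
  (hw.continuous_iteratedFDeriv (mod_cast le_top)).bounded_above_of_compact_support
    (hc.iteratedFDeriv k)

/-- The germ at `0` of `t ↦ t ^ n / n!` has `m`-th derivative `δₘₙ`. -/
lemma iteratedDeriv_of_eventuallyEq_pow_div_factorial {η : ℝ → ℝ} {n : ℕ}
    (hη : η =ᶠ[𝓝 0] fun t => t ^ n / n !) (m : ℕ) :
    iteratedDeriv m η 0 = if n = m then 1 else 0 := by
  rw [hη.iteratedDeriv_eq]
  simp only [div_eq_mul_inv]
  rw [iteratedDeriv_mul_const_field, iteratedDeriv_fun_pow_zero]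
  by_cases h : m = n
  · simp [h, Nat.factorial_ne_zero]
  · simp [h, Ne.symm h]

/-- **Borel's lemma** for finitely many families of compactly supported parametric coefficients,
with cutoff monomials `η n` common to all the families. -/
theorem exists_borel_cutoffs {ι : Type*} [Finite ι] [CompleteSpace V] (h : ι → ℕ → E → V)
    (hh : ∀ i n, ContDiff ℝ ∞ (h i n)) (hc : ∀ i n, HasCompactSupport (h i n)) :
    ∃ η : ℕ → ℝ → ℝ, ∀ i,
      ContDiff ℝ ∞ (fun p : E × ℝ => ∑' n, η n p.2 • h i n p.1) ∧
      ∀ y m, iteratedDeriv m (fun t => ∑' n, η n t • h i n y) 0 = h i m y := by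
  let χ : ContDiffBump (0 : ℝ) := ⟨1, 2, one_pos, one_lt_two⟩
  let ψ : ℕ → ℝ → ℝ := fun n s => χ s * (s ^ n / n !)
  have hψ : ∀ n, ContDiff ℝ ∞ (ψ n) := fun n =>
    χ.contDiff.mul ((contDiff_id.pow n).div_const _)
  let w : ι → ℕ → E × ℝ → V := fun i n p => ψ n p.2 • h i n p.1
  have hw : ∀ i n, ContDiff ℝ ∞ (w i n) := fun i n =>
    ((hψ n).comp contDiff_snd).smul ((hh i n).comp contDiff_fst)
  have hwc : ∀ i n, HasCompactSupport (w i n) := by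
    intro i n
    refine HasCompactSupport.intro ((hc i n).isCompact.prod χ.hasCompactSupport.isCompact) ?_
    rintro ⟨y, s⟩ hys
    rw [Set.mem_prod, not_and_or] at hys
    rcases hys with hy | hs
    · simp [w, image_eq_zero_of_notMem_tsupport hy]
    · simp [w, ψ, image_eq_zero_of_notMem_tsupport hs]
  choose C hC using fun i n => exists_bound_iteratedFDeriv (hw i n) (hwc i n)
  obtain ⟨L, hL, hCL⟩ := exists_scales C
  have hL0 : ∀ n, 0 < L n := fun n => one_pos.trans_le (hL n)
  let η : ℕ → ℝ → ℝ := fun n t => (L n ^ n)⁻¹ * ψ n (L n * t)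
  have hη : ∀ n, ContDiff ℝ ∞ (η n) := fun n =>
    contDiff_const.mul ((hψ n).comp (contDiff_const.mul contDiff_id))
  have hη0 : ∀ n, η n =ᶠ[𝓝 0] fun t => t ^ n / n ! := by
    intro n
    have ht : Filter.Tendsto (fun t => L n * t) (𝓝 0) (𝓝 0) := by
      simpa using (continuous_const_mul (L n)).tendsto 0
    filter_upwards [ht.eventually χ.eventuallyEq_one] with t h1
    have := (hL0 n).ne'
    simp only [η, ψ, h1, Pi.one_apply]
    rw [mul_pow]
    field_simp
  refine ⟨η, fun i => ?_⟩
  let u : ℕ → E × ℝ → V := fun n p => η n p.2 • h i n p.1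
  have hu : ∀ n, ContDiff ℝ ∞ (u n) := fun n =>
    ((hη n).comp contDiff_snd).smul ((hh i n).comp contDiff_fst)
  let v : ℕ → ℕ → ℝ := fun k n => (L n ^ n)⁻¹ * (C i n k * L n ^ k)
  have huv : ∀ k n p, ‖iteratedFDeriv ℝ k (u n) p‖ ≤ v k n := by
    intro k n p
    have hw' : ContDiff ℝ ∞ fun q : E × ℝ => w i n (q.1, L n * q.2) :=
      (hw i n).comp (contDiff_fst.prodMk (contDiff_const.mul contDiff_snd))
    have hu_eq : u n = (L n ^ n)⁻¹ • fun q : E × ℝ => w i n (q.1, L n * q.2) := by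
      ext q; simp [u, η, w, mul_smul]
    rw [hu_eq, iteratedFDeriv_const_smul_apply (hw'.contDiffAt.of_le (mod_cast le_top)), norm_smul,
      Real.norm_of_nonneg (by have := hL0 n; positivity)]
    have := hL0 n
    exact mul_le_mul_of_nonneg_left
      (norm_iteratedFDeriv_stretch_le (hw i n) (hC i n k) (hL n) p) (by positivity)
  have hv0 : ∀ k n, 0 ≤ v k n := fun k n => (norm_nonneg _).trans (huv k n 0)
  have hv : ∀ k, Summable (v k) := by
    intro k
    refine summable_of_isBigO_nat summable_geometric_two (Asymptotics.IsBigO.of_bound 1 ?_)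
    filter_upwards [Filter.eventually_gt_atTop k] with n hn
    rw [one_mul, Real.norm_of_nonneg (hv0 k n), Real.norm_of_nonneg (by positivity)]
    exact hCL i n k hn
  have hF : ContDiff ℝ ∞ fun p => ∑' n, u n p :=
    contDiff_tsum (N := ⊤) hu (fun k _ => hv k) fun k n p _ => huv k n p
  refine ⟨hF, fun y m => ?_⟩
  have hsum : Summable fun n => iteratedFDeriv ℝ m (u n) (y, 0) :=
    (hv m).of_norm_bounded fun n => huv m n _
  calc iteratedDeriv m (fun t => ∑' n, u n (y, t)) 0
      = ∑' n, iteratedDeriv m (fun t => u n (y, t)) 0 := by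
        simp only [iteratedDeriv_slice hF, iteratedDeriv_slice (hu _)]
        rw [iteratedFDeriv_tsum_apply (N := ⊤) hu (fun k _ => hv k) (fun k n p _ => huv k n p)
          le_top, ContinuousMultilinearMap.tsum_eval hsum]
    _ = ∑' n, if n = m then h i m y else 0 := by
        refine tsum_congr fun n => ?_
        rw [show (fun t => u n (y, t)) = fun t => η n t • h i n y from rfl,
          iteratedDeriv_smul_const ((hη n).contDiffAt.of_le (mod_cast le_top)),
          iteratedDeriv_of_eventuallyEq_pow_div_factorial (hη0 n)]
        split_ifs with hnm <;> simp [hnm]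
    _ = h i m y := tsum_ite_eq m _

end

/-- **Parametric Borel's Lemma** on a compact manifold: a sequence of smooth maps
`α n : M → V` is the sequence of `t`-derivatives at `0` of a jointly smooth map
`f : M × ℝ → V`. -/
theorem parametric_borel_lemma
    {E : Type*} [NormedAddCommGroup E] [NormedSpace ℝ E] [FiniteDimensional ℝ E]
    {H : Type*} [TopologicalSpace H] (I : ModelWithCorners ℝ E H) [I.Boundaryless]
    {M : Type*} [TopologicalSpace M] [ChartedSpace H M] [IsManifold I (⊤ : ℕ∞) M]
    [CompactSpace M]
    {V : Type*} [NormedAddCommGroup V] [NormedSpace ℝ V] [FiniteDimensional ℝ V]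
    (α : ℕ → M → V) (hα : ∀ n : ℕ, ContMDiff I 𝓘(ℝ, V) (⊤ : ℕ∞) (α n)) :
    ∃ f : M × ℝ → V,
      ContMDiff (I.prod 𝓘(ℝ, ℝ)) 𝓘(ℝ, V) (⊤ : ℕ∞) f ∧
      ∀ (x : M) (n : ℕ), iteratedDeriv n (fun t => f (x, t)) 0 = α n x := by
  have hbump : ∀ x : M, ∃ β : ContDiffBump (extChartAt I x x),
      tsupport β ⊆ (extChartAt I x).target := by
    intro x
    obtain ⟨r, hr, hsub⟩ :=
      Metric.nhds_basis_closedBall.mem_iff.1 (extChartAt_target_mem_nhds (I := I) x)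
    refine ⟨⟨r / 2, r, half_pos hr, half_lt_self hr⟩, ?_⟩
    rwa [ContDiffBump.tsupport_eq]
  choose β hβ using hbump
  let U : M → Set M := fun x =>
    (extChartAt I x).source ∩ extChartAt I x ⁻¹' Metric.ball (extChartAt I x x) (β x).rIn
  have hUo : ∀ x, IsOpen (U x) := fun x =>
    (continuousOn_extChartAt x).isOpen_inter_preimage (isOpen_extChartAt_source x)
      Metric.isOpen_ball
  have hxU : ∀ x, x ∈ U x := fun x =>
    ⟨mem_extChartAt_source x, Metric.mem_ball_self (β x).rIn_pos⟩
  obtain ⟨s, hs⟩ := CompactSpace.elim_nhds_subcover U fun x => (hUo x).mem_nhds (hxU x)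
  have hcover : ∀ x, ∃ c : s, x ∈ U c := by
    intro x
    have hx : x ∈ ⋃ c ∈ s, U c := hs ▸ Set.mem_univ x
    obtain ⟨c, hc, hxc⟩ := Set.mem_iUnion₂.1 hx
    exact ⟨⟨c, hc⟩, hxc⟩
  let h : s → ℕ → E → V := fun c n y => β c y • α n ((extChartAt I (c : M)).symm y)
  have hh : ∀ c n, ContDiff ℝ ∞ (h c n) := by
    intro c n
    have hα' : ContDiffOn ℝ ∞ (α n ∘ (extChartAt I (c : M)).symm) (extChartAt I (c : M)).target :=
      ((hα n).comp_contMDiffOn (contMDiffOn_extChartAt_symm (c : M))).contDiffOn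
    refine contDiff_iff_contDiffAt.2 fun y => ?_
    by_cases hy : y ∈ (extChartAt I (c : M)).target
    · exact (β c).contDiffAt.smul
        (hα'.contDiffAt ((isOpen_extChartAt_target (I := I) (c : M)).mem_nhds hy))
    · refine (contDiffAt_const (c := (0 : V))).congr_of_eventuallyEq ?_
      filter_upwards [notMem_tsupport_iff_eventuallyEq.1 fun hy' => hy (hβ c hy')] with z hz
      rw [Pi.zero_apply] at hz
      simp only [h, hz, zero_smul]
  have hc : ∀ c n, HasCompactSupport (h c n) := fun c n => (β c).hasCompactSupport.smul_right
  have hhα : ∀ (c : s) n x, x ∈ U c → h c n (extChartAt I (c : M) x) = α n x := by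
    intro c n x hx
    simp only [h]
    rw [(β c).one_of_mem_closedBall (Metric.ball_subset_closedBall hx.2), one_smul,
      (extChartAt I (c : M)).left_inv hx.1]
  have : CompleteSpace V := FiniteDimensional.complete ℝ V
  obtain ⟨η, hη⟩ := exists_borel_cutoffs h hh hc
  refine ⟨fun p => ∑' n, η n p.2 • α n p.1, ?_, fun x m => ?_⟩
  · rintro ⟨x, t⟩
    obtain ⟨c, hxc⟩ := hcover x
    have hchart : ContMDiffAt (I.prod 𝓘(ℝ, ℝ)) 𝓘(ℝ, E × ℝ) ∞
        (fun p : M × ℝ => (extChartAt I (c : M) p.1, p.2)) (x, t) :=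
      ((contMDiffAt_extChartAt' (by simpa using hxc.1)).comp (x, t)
        contMDiffAt_fst).prodMk_space contMDiffAt_snd
    refine ((hη c).1.contMDiff.contMDiffAt.comp (x, t) hchart).congr_of_eventuallyEq ?_
    filter_upwards [continuous_fst.continuousAt.preimage_mem_nhds ((hUo c).mem_nhds hxc)]
      with p hp
    simp only [Function.comp_apply, hhα c _ p.1 hp]
  · obtain ⟨c, hxc⟩ := hcover x
    simpa only [hhα c _ x hxc] using (hη c).2 (extChartAt I (c : M) x) m
end

section
/- Realization of a formal family of nondegenerate skew forms (matrix version of the paper's refined Borel lemma): Let M be a compact smooth manifold, s ∈ ℕ, and let (ω^k)_{k∈ℕ} be a sequence of smooth maps ω^k : M → Matrix (Fin s) (Fin s) ℝ such that each matrix ω^k(x) is antisymmetric and ω^0(x) is invertible for every x ∈ M. Then there exist ε > 0 and a jointly smooth map Ω : M × ℝ → Matrix (Fin s) (Fin s) ℝ such that: (i) Ω(x,t) is antisymmetric for all (x,t); (ii) for every x ∈ M and k ∈ ℕ, the k-th iterated derivative at t = 0 of t ↦ Ω(x,t) equals k! · ω^k(x); and (iii) Ω(x,t) is invertible for every x ∈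 M and every t with |t| < ε. -/
open scoped Manifold Matrix

attribute [local instance] Matrix.normedAddCommGroup Matrix.normedSpace
attribute [-instance] instTopologicalSpaceMatrix Matrix.instUniformSpace

section Borel

open scoped ContDiff Topology
open Filter

variable {A E F : Type*} [NormedAddCommGroup E] [NormedSpace ℝ E]
  [NormedAddCommGroup F] [NormedSpace ℝ F]

/-- Rescaling the last variable by `ε⁻¹` costs at most a factor `ε⁻¹` per derivative. -/
theorem norm_iteratedFDeriv_smul_comp_scale_snd_le {f : E × ℝ → F} (hf : ContDiff ℝ ∞ f)
    {ε : ℝ} (hε : 0 < ε) (hε1 : ε ≤ 1) (k i : ℕ) {C : ℝ}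
    (hC : ∀ p, ‖iteratedFDeriv ℝ i f p‖ ≤ C) (p : E × ℝ) :
    ‖iteratedFDeriv ℝ i (fun p : E × ℝ => ε ^ k • f (p.1, ε⁻¹ * p.2)) p‖ ≤
      ε ^ k * (C * ε⁻¹ ^ i) := by
  let L : E × ℝ →L[ℝ] E × ℝ :=
    (ContinuousLinearMap.fst ℝ E ℝ).prod (ε⁻¹ • ContinuousLinearMap.snd ℝ E ℝ)
  have hinv : 1 ≤ ε⁻¹ := (one_le_inv₀ hε).2 hε1
  have hL : ‖L‖ ≤ ε⁻¹ := by
    refine ContinuousLinearMap.opNorm_le_bound _ (by positivity) fun q => ?_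
    refine max_le ?_ ?_
    · calc ‖q.1‖ ≤ ‖q‖ := norm_fst_le q
        _ ≤ ε⁻¹ * ‖q‖ := le_mul_of_one_le_left (norm_nonneg _) hinv
    · calc ‖ε⁻¹ • q.2‖ = ε⁻¹ * ‖q.2‖ := by
            rw [norm_smul, Real.norm_of_nonneg (by positivity)]
        _ ≤ ε⁻¹ * ‖q‖ := by gcongr; exact norm_snd_le q
  have hcomp : ContDiff ℝ i (f ∘ L) :=
    (hf.comp L.contDiff).of_le (by exact_mod_cast le_top)
  have heq : (fun p : E × ℝ => ε ^ k • f (p.1, ε⁻¹ * p.2)) = fun p => ε ^ k • (f ∘ L) p := rfl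
  have hC0 : 0 ≤ C := (norm_nonneg _).trans (hC p)
  rw [heq, iteratedFDeriv_const_smul_apply' hcomp.contDiffAt, norm_smul,
    Real.norm_of_nonneg (by positivity),
    L.iteratedFDeriv_comp_right hf p (by exact_mod_cast le_top)]
  gcongr
  refine (ContinuousMultilinearMap.norm_compContinuousLinearMap_le _ _).trans ?_
  rw [Finset.prod_const, Finset.card_univ, Fintype.card_fin]
  gcongr
  exact hC _

/-- For finitely many compactly supported smooth `g a`, there is a cut-off `c` of the monomial
`t ^ k` such that the derivatives of `c t • g a y` of order less than `k` are at most `2⁻ᵏ`. -/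
theorem exists_cutoff_pow_iteratedFDeriv_le [Finite A] (k : ℕ) (g : A → E → F)
    (hg : ∀ a, ContDiff ℝ ∞ (g a)) (hgc : ∀ a, HasCompactSupport (g a)) :
    ∃ c : ℝ → ℝ, ContDiff ℝ ∞ c ∧ c =ᶠ[𝓝 0] (fun t => t ^ k) ∧ ∀ a,
      (∀ i, ∃ C, ∀ p, ‖iteratedFDeriv ℝ i (fun p : E × ℝ => c p.2 • g a p.1) p‖ ≤ C) ∧
      ∀ i < k, ∀ p,
        ‖iteratedFDeriv ℝ i (fun p : E × ℝ => c p.2 • g a p.1) p‖ ≤ (1 / 2) ^ k := by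
  cases nonempty_fintype A
  let χ : ContDiffBump (0 : ℝ) := default
  let ψ : ℝ → ℝ := fun t => t ^ k * χ t
  have hψ : ContDiff ℝ ∞ ψ := (contDiff_id.pow k).mul χ.contDiff
  have hψc : HasCompactSupport ψ := χ.hasCompactSupport.mul_left
  let f : A → E × ℝ → F := fun a p => ψ p.2 • g a p.1
  have hf : ∀ a, ContDiff ℝ ∞ (f a) := fun a =>
    (hψ.comp contDiff_snd).smul ((hg a).comp contDiff_fst)
  have hfc : ∀ a, HasCompactSupport (f a) := fun a => by
    refine HasCompactSupport.intro ((hgc a).isCompact.prod hψc.isCompact) fun p hp => ?_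
    rw [Set.mem_prod, not_and_or] at hp
    rcases hp with hp | hp
    · simp [f, image_eq_zero_of_notMem_tsupport hp]
    · simp [f, image_eq_zero_of_notMem_tsupport hp]
  have hbound : ∀ a i, ∃ C, ∀ p, ‖iteratedFDeriv ℝ i (f a) p‖ ≤ C := fun a i =>
    ((hf a).continuous_iteratedFDeriv (by exact_mod_cast le_top)).bounded_above_of_compact_support
      ((hfc a).iteratedFDeriv i)
  choose C hC using hbound
  have hC0 : ∀ a i, 0 ≤ C a i := fun a i => (norm_nonneg _).trans (hC a i 0)
  let K : ℝ := 1 + ∑ a, ∑ i ∈ Finset.range k, C a i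
  have hK : 1 ≤ K := le_add_of_nonneg_right
    (Finset.sum_nonneg fun a _ => Finset.sum_nonneg fun i _ => hC0 a i)
  have hCK : ∀ a, ∀ i < k, C a i ≤ K := fun a i hi =>
    calc C a i ≤ ∑ i ∈ Finset.range k, C a i :=
          Finset.single_le_sum (f := C a) (fun i _ => hC0 a i) (Finset.mem_range.2 hi)
      _ ≤ ∑ a, ∑ i ∈ Finset.range k, C a i :=
          Finset.single_le_sum (f := fun a => ∑ i ∈ Finset.range k, C a i)
            (fun a _ => Finset.sum_nonneg fun i _ => hC0 a i) (Finset.mem_univ a)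
      _ ≤ K := le_add_of_nonneg_left zero_le_one
  have hKpos : 0 < K := zero_lt_one.trans_le hK
  let ε : ℝ := (1 / 2) ^ k / K
  have hε : 0 < ε := by positivity
  have hε1 : ε ≤ 1 := div_le_one_of_le₀
    ((pow_le_one₀ (by norm_num) (by norm_num)).trans hK) hKpos.le
  have hscale : ∀ a i p, ‖iteratedFDeriv ℝ i
      (fun p : E × ℝ => (ε ^ k * ψ (ε⁻¹ * p.2)) • g a p.1) p‖ ≤
        ε ^ k * (C a i * ε⁻¹ ^ i) := fun a i p => by
    simpa only [f, smul_smul] using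
      norm_iteratedFDeriv_smul_comp_scale_snd_le (hf a) hε hε1 k i (hC a i) p
  refine ⟨fun t => ε ^ k * ψ (ε⁻¹ * t), ?_, ?_, fun a => ⟨fun i => ⟨_, hscale a i⟩, ?_⟩⟩
  · exact contDiff_const.mul (hψ.comp (contDiff_const.mul contDiff_id))
  · have htend : Tendsto (fun t : ℝ => ε⁻¹ * t) (𝓝 0) (𝓝 0) := by
      simpa using (continuous_const_mul ε⁻¹).tendsto (0 : ℝ)
    filter_upwards [htend.eventually χ.eventuallyEq_one] with t ht
    simp only [ψ, ht, Pi.one_apply, mul_one]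
    rw [← mul_pow, mul_inv_cancel_left₀ hε.ne']
  · intro i hi p
    refine (hscale a i p).trans ?_
    obtain ⟨m, rfl⟩ := Nat.exists_eq_add_of_lt hi
    calc ε ^ (i + m + 1) * (C a i * ε⁻¹ ^ i)
        = ε ^ m * (ε * C a i) * (ε * ε⁻¹) ^ i := by rw [pow_succ, pow_add, mul_pow]; ring
      _ = ε ^ m * (ε * C a i) := by rw [mul_inv_cancel₀ hε.ne', one_pow, mul_one]
      _ ≤ 1 * (ε * K) := by
          gcongr
          · exact mul_nonneg hε.le (hC0 a i)
          · exact pow_le_one₀ hε.le hε1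
          · exact hCK a i hi
      _ = (1 / 2) ^ (i + m + 1) := by rw [one_mul, div_mul_cancel₀ _ hKpos.ne']

/-- Cut-offs of all monomials making the Borel series of finitely many sequences of compactly
supported smooth maps converge with all derivatives. -/
theorem exists_cutoff_pow_summable_iteratedFDeriv [Finite A] (g : A → ℕ → E → F)
    (hg : ∀ a k, ContDiff ℝ ∞ (g a k)) (hgc : ∀ a k, HasCompactSupport (g a k)) :
    ∃ c : ℕ → ℝ → ℝ, (∀ k, ContDiff ℝ ∞ (c k)) ∧ (∀ k, c k =ᶠ[𝓝 0] (fun t => t ^ k)) ∧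
      ∀ a, ∃ v : ℕ → ℕ → ℝ, (∀ i, Summable (v i)) ∧ ∀ i k p,
        ‖iteratedFDeriv ℝ i (fun p : E × ℝ => c k p.2 • g a k p.1) p‖ ≤ v i k := by
  choose c hc hc0 hbd using fun k =>
    exists_cutoff_pow_iteratedFDeriv_le k (fun a => g a k) (fun a => hg a k) (fun a => hgc a k)
  refine ⟨c, hc, hc0, fun a => ?_⟩
  choose C hC using fun k => (hbd k a).1
  refine ⟨fun i k => if i < k then (1 / 2) ^ k else C k i, fun i => ?_, fun i k p => ?_⟩
  · refine (summable_congr_cofinite ?_).1 (summable_geometric_of_lt_one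
      (by norm_num : (0 : ℝ) ≤ 1 / 2) (by norm_num))
    rw [Nat.cofinite_eq_atTop]
    filter_upwards [eventually_gt_atTop i] with k hk
    rw [if_pos hk]
  · dsimp only
    split_ifs with h
    · exact (hbd k a).2 i h p
    · exact hC k i p

theorem iteratedDeriv_prodMk_eq_iteratedFDeriv {G : E × ℝ → F} (hG : ContDiff ℝ ∞ G)
    (k : ℕ) (y : E) (t : ℝ) :
    iteratedDeriv k (fun t => G (y, t)) t = iteratedFDeriv ℝ k G (y, t) fun _ => (0, 1) := by
  have heq : (fun t => G (y, t)) =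
      (fun p => G ((y, 0) + p)) ∘ ContinuousLinearMap.inr ℝ E ℝ := by
    ext t; simp
  have hG' : ContDiff ℝ ∞ fun p => G ((y, 0) + p) := hG.comp (contDiff_const.add contDiff_id)
  rw [iteratedDeriv_eq_iteratedFDeriv, heq,
    ContinuousLinearMap.iteratedFDeriv_comp_right _ hG' t (by exact_mod_cast le_top),
    iteratedFDeriv_comp_add_left]
  simp

/-- Term-by-term differentiation in the last variable. -/
theorem iteratedDeriv_tsum_prodMk [CompleteSpace F] {f : ℕ → E × ℝ → F}
    (hf : ∀ j, ContDiff ℝ ∞ (f j)) {v : ℕ → ℕ → ℝ} (hv : ∀ i, Summable (v i))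
    (hfv : ∀ i j p, ‖iteratedFDeriv ℝ i (f j) p‖ ≤ v i j) (k : ℕ) (y : E) (t : ℝ) :
    iteratedDeriv k (fun t => ∑' j, f j (y, t)) t =
      ∑' j, iteratedDeriv k (fun t => f j (y, t)) t := by
  have hS : ContDiff ℝ ∞ fun p => ∑' j, f j p :=
    contDiff_tsum hf (fun i _ => hv i) fun i j p _ => hfv i j p
  have hsum : Summable fun j => iteratedFDeriv ℝ k (f j) (y, t) :=
    Summable.of_norm_bounded (hv k) fun j => hfv k j _
  rw [iteratedDeriv_prodMk_eq_iteratedFDeriv hS,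
    iteratedFDeriv_tsum hf (fun i _ => hv i) (fun i j p _ => hfv i j p) (k := k) le_top]
  simp_rw [iteratedDeriv_prodMk_eq_iteratedFDeriv (hf _)]
  exact (ContinuousMultilinearMap.apply ℝ (fun _ : Fin k => E × ℝ) F
    fun _ => (0, 1)).map_tsum hsum

theorem iteratedDeriv_tsum_cutoff_smul_zero {c : ℕ → ℝ → ℝ} (hc : ∀ k, ContDiff ℝ ∞ (c k))
    (hc0 : ∀ k, c k =ᶠ[𝓝 0] (fun t => t ^ k)) (w : ℕ → F) (k : ℕ) :
    ∑' j, iteratedDeriv k (fun t => c j t • w j) 0 = (k.factorial : ℝ) • w k := by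
  have hterm : ∀ j, iteratedDeriv k (fun t => c j t • w j) 0 =
      if j = k then (k.factorial : ℝ) • w k else 0 := fun j => by
    have hcj : ContDiffAt ℝ k (c j) 0 := ((hc j).of_le (by exact_mod_cast le_top)).contDiffAt
    rw [iteratedDeriv_smul_const hcj, (hc0 j).iteratedDeriv_eq, iteratedDeriv_fun_pow_zero]
    rcases eq_or_ne j k with rfl | h
    · simp
    · simp [h, h.symm]
  simp_rw [hterm]
  exact tsum_ite_eq k _

end Borel

section Manifold

open scoped ContDiff Topology
open Filter

variable {E : Type*} [NormedAddCommGroup E] [NormedSpace ℝ E] [FiniteDimensional ℝ E]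
  {H : Type*} [TopologicalSpace H] {I : ModelWithCorners ℝ E H} [I.Boundaryless]
  {M : Type*} [TopologicalSpace M] [ChartedSpace H M] [IsManifold I ∞ M]
  {F : Type*} [NormedAddCommGroup F] [NormedSpace ℝ F]

/-- A smooth map read in a chart and multiplied by a bump function supported in the chart is
globally smooth. -/
theorem ContMDiff.contDiff_bump_smul_comp_extChartAt_symm {f : M → F}
    (hf : ContMDiff I 𝓘(ℝ, F) ∞ f) (x : M) (φ : ContDiffBump (extChartAt I x x))
    (hφ : Metric.closedBall (extChartAt I x x) φ.rOut ⊆ (extChartAt I x).target) :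
    ContDiff ℝ ∞ fun y => φ y • f ((extChartAt I x).symm y) := by
  rw [contDiff_iff_contDiffAt]
  intro y
  by_cases hy : y ∈ (extChartAt I x).target
  · have hsymm := (contMDiffOn_extChartAt_symm (I := I) (n := ∞) x).contMDiffAt
      ((isOpen_extChartAt_target (I := I) x).mem_nhds hy)
    exact φ.contDiffAt.smul (hf.contMDiffAt.comp y hsymm).contDiffAt
  · have hy' : y ∉ tsupport φ := fun h => hy (hφ (φ.tsupport_eq ▸ h))
    refine contDiffAt_const (c := (0 : F)) |>.congr_of_eventuallyEq ?_
    filter_upwards [notMem_tsupport_iff_eventuallyEq.1 hy'] with z hz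
    rw [hz, Pi.zero_apply, zero_smul]

variable [CompactSpace M] [CompleteSpace F]

/-- **Borel's lemma with parameters** in a compact manifold: every sequence of smooth maps is,
up to factorials, the sequence of derivatives at `t = 0` of a jointly smooth family, given by a
series whose coefficients depend only on `t`. -/
theorem exists_contMDiff_tsum_smul_iteratedDeriv_eq (w : ℕ → M → F)
    (hw : ∀ k, ContMDiff I 𝓘(ℝ, F) ∞ (w k)) :
    ∃ c : ℕ → ℝ → ℝ,
      ContMDiff (I.prod 𝓘(ℝ, ℝ)) 𝓘(ℝ, F) ∞ (fun p : M × ℝ => ∑' k, c k p.2 • w k p.1) ∧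
      ∀ x k, iteratedDeriv k (fun t => ∑' j, c j t • w j x) 0 = (k.factorial : ℝ) • w k x := by
  have hbump : ∀ x : M, ∃ φ : ContDiffBump (extChartAt I x x),
      Metric.closedBall (extChartAt I x x) φ.rOut ⊆ (extChartAt I x).target := fun x => by
    obtain ⟨r, hr, hsub⟩ := Metric.nhds_basis_closedBall.mem_iff.1
      (extChartAt_target_mem_nhds (I := I) x)
    exact ⟨⟨r / 2, r, half_pos hr, half_lt_self hr⟩, hsub⟩
  choose φ hφ using hbump
  have hU : ∀ x : M, {z | z ∈ (chartAt H x).source ∧ φ x =ᶠ[𝓝 (extChartAt I x z)] 1} ∈ 𝓝 x :=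
    fun x => by
      filter_upwards [(chartAt H x).open_source.mem_nhds (mem_chart_source H x),
        (continuousAt_extChartAt (I := I) x).eventually (φ x).eventuallyEq_one.eventually_nhds]
        with z hz hz'
      exact ⟨hz, hz'⟩
  obtain ⟨s, hs⟩ := CompactSpace.elim_nhds_subcover _ hU
  let g : s → ℕ → E → F := fun a k y => φ a y • w k ((extChartAt I (a : M)).symm y)
  have hg : ∀ a k, ContDiff ℝ ∞ (g a k) := fun a k =>
    (hw k).contDiff_bump_smul_comp_extChartAt_symm _ (φ a) (hφ a)
  obtain ⟨c, hc, hc0, hsum⟩ := exists_cutoff_pow_summable_iteratedFDeriv g hg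
    fun a k => (φ a).hasCompactSupport.smul_right
  have hterm : ∀ a k, ContDiff ℝ ∞ fun p : E × ℝ => c k p.2 • g a k p.1 := fun a k =>
    ((hc k).comp contDiff_snd).smul ((hg a k).comp contDiff_fst)
  have hcover : ∀ x : M, ∃ a : s, x ∈ (chartAt H (a : M)).source ∧
      φ a =ᶠ[𝓝 (extChartAt I (a : M) x)] 1 := fun x => by
    have hx : x ∈ (⊤ : Set M) := trivial
    rw [← hs] at hx
    simpa using hx
  have hread : ∀ (a : s) (z : M), z ∈ (chartAt H (a : M)).source →
      φ a (extChartAt I (a : M) z) = 1 → ∀ k, g a k (extChartAt I (a : M) z) = w k z :=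
    fun a z hz hz1 k => by
      simp only [g, hz1, one_smul]
      rw [(extChartAt I (a : M)).left_inv (by rwa [extChartAt_source])]
  refine ⟨c, fun p => ?_, fun x k => ?_⟩
  · obtain ⟨a, ha, ha1⟩ := hcover p.1
    obtain ⟨v, hv, hbd⟩ := hsum a
    have hS : ContDiff ℝ ∞ fun q : E × ℝ => ∑' k, c k q.2 • g a k q.1 :=
      contDiff_tsum (hterm a) (fun i _ => hv i) fun i j q _ => hbd i j q
    have hchart : ContMDiffAt I 𝓘(ℝ, E) ∞ (extChartAt I (a : M)) p.1 :=
      contMDiffAt_extChartAt' ha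
    have hmap : ContMDiffAt (I.prod 𝓘(ℝ, ℝ)) 𝓘(ℝ, E × ℝ) ∞
        (fun q : M × ℝ => (extChartAt I (a : M) q.1, q.2)) p :=
      (hchart.comp p contMDiffAt_fst).prodMk_space contMDiffAt_snd
    refine (hS.contDiffAt.contMDiffAt.comp p hmap).congr_of_eventuallyEq ?_
    have hfst : Tendsto (Prod.fst : M × ℝ → M) (𝓝 p) (𝓝 p.1) := continuous_fst.tendsto p
    filter_upwards [hfst.eventually ((chartAt H (a : M)).open_source.mem_nhds ha),
      hfst.eventually (hchart.continuousAt.eventually ha1)] with q hq hq1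
    simp only [Function.comp_apply, hread a q.1 hq hq1]
  · obtain ⟨a, ha, ha1⟩ := hcover x
    obtain ⟨v, hv, hbd⟩ := hsum a
    have := iteratedDeriv_tsum_prodMk (hterm a) hv hbd k (extChartAt I (a : M) x) 0
    simp only [hread a x ha ha1.eq_of_nhds] at this
    rw [this, iteratedDeriv_tsum_cutoff_smul_zero hc hc0]

end Manifold

/-- **Realization of a formal family of nondegenerate skew forms** (matrix version of the
paper's refined Borel lemma): a sequence of smooth antisymmetric-matrix-valued maps
`ωᵏ : M → Mₛ(ℝ)` on a compact manifold, with `ω⁰` pointwise invertible, is the ∞-jet at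
`t = 0` of a jointly smooth antisymmetric family `Ω(x,t)` which is invertible for all
`|t| < ε`. -/
theorem realization_of_formal_symplectic_family
    {E : Type*} [NormedAddCommGroup E] [NormedSpace ℝ E] [FiniteDimensional ℝ E]
    {H : Type*} [TopologicalSpace H] (I : ModelWithCorners ℝ E H) [I.Boundaryless]
    {M : Type*} [TopologicalSpace M] [ChartedSpace H M] [IsManifold I (⊤ : ℕ∞) M]
    [CompactSpace M] (s : ℕ)
    (ω : ℕ → M → Matrix (Fin s) (Fin s) ℝ)
    (hsm : ∀ k : ℕ, ContMDiff I 𝓘(ℝ, Matrix (Fin s) (Fin s) ℝ) (⊤ : ℕ∞) (ω k))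
    (hanti : ∀ k : ℕ, ∀ x : M, (ω k x)ᵀ = -(ω k x))
    (hinv : ∀ x : M, IsUnit (ω 0 x)) :
    ∃ ε > (0 : ℝ), ∃ Ω : M × ℝ → Matrix (Fin s) (Fin s) ℝ,
      ContMDiff (I.prod 𝓘(ℝ, ℝ)) 𝓘(ℝ, Matrix (Fin s) (Fin s) ℝ) (⊤ : ℕ∞) Ω ∧
      (∀ (x : M) (t : ℝ), (Ω (x, t))ᵀ = -(Ω (x, t))) ∧
      (∀ (x : M) (k : ℕ),
        iteratedDeriv k (fun t => Ω (x, t)) 0 = (k.factorial : ℝ) • ω k x) ∧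
      (∀ (x : M) (t : ℝ), |t| < ε → IsUnit (Ω (x, t))) := by
  obtain ⟨c, hsmooth, hderiv⟩ := exists_contMDiff_tsum_smul_iteratedDeriv_eq ω hsm
  let Ω : M × ℝ → Matrix (Fin s) (Fin s) ℝ := fun p => ∑' k, c k p.2 • ω k p.1
  have hzero : ∀ x, Ω (x, 0) = ω 0 x := fun x => by simpa using hderiv x 0
  have hdet : Continuous fun p => (Ω p).det :=
    Continuous.matrix_det (R := ℝ) hsmooth.continuous
  obtain ⟨U, V, -, hV, hU, h0V, hUV⟩ := generalized_tube_lemma (isCompact_univ (X := M))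
    (isCompact_singleton (x := (0 : ℝ))) (isOpen_ne.preimage hdet) (by
      rintro ⟨x, t⟩ ⟨-, rfl⟩
      have := (Matrix.isUnit_iff_isUnit_det _).1 (hinv x)
      rw [← hzero] at this
      exact this.ne_zero)
  obtain ⟨ε, hε, hball⟩ := Metric.isOpen_iff.1 hV 0 (h0V rfl)
  refine ⟨ε, hε, Ω, hsmooth, fun x t => ?_, hderiv, fun x t ht => ?_⟩
  · let T := (Matrix.transposeLinearEquiv (Fin s) (Fin s) ℝ ℝ).toContinuousLinearEquiv
    calc (Ω (x, t))ᵀ = ∑' k, (c k t • ω k x)ᵀ := T.map_tsum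
      _ = ∑' k, -(c k t • ω k x) := by simp_rw [Matrix.transpose_smul, hanti, smul_neg]
      _ = -(Ω (x, t)) := tsum_neg
  · refine (Matrix.isUnit_iff_isUnit_det _).2 (isUnit_iff_ne_zero.2 ?_)
    exact hUV (Set.mk_mem_prod (hU (Set.mem_univ x)) (hball (by simpa using ht)))
end
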